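/- arXiv:2201.05911 — 5 statements merged into one kernel-verified Lean document; each statement's English description precedes it below -/
import Mathlib

section
/- Let μ₁ and μ₂ be finite Borel measures on ℝ². If for all real numbers a, b not both zero the pushforward measures of μ₁ and μ₂ along the map (x,y) ↦ ax + by from ℝ² to ℝ are equal, then μ₁ = μ₂. -/
open MeasureTheory

/-- If two finite Borel measures on ℝ² have equal pushforwards along
every map `(x,y) ↦ ax + by` with `a, b` not both zero, then they are equal. -/
theorem finite_measures_eq_of_linear_pushforwards_eq
    (μ₁ μ₂ : Measure (ℝ × ℝ)) [IsFiniteMeasure μ₁] [IsFiniteMeasure μ₂]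
    (h : ∀ a b : ℝ, ¬(a = 0 ∧ b = 0) →
      Measure.map (fun z : ℝ × ℝ => a * z.1 + b * z.2) μ₁ =
      Measure.map (fun z : ℝ × ℝ => a * z.1 + b * z.2) μ₂) :
    μ₁ = μ₂ := by
  have mass : μ₁.real Set.univ = μ₂.real Set.univ := by
    have hmap := congrArg (fun ν => ν Set.univ) (h 1 0 (by simp))
    simp only [Measure.map_apply (by fun_prop : Measurable fun z : ℝ × ℝ => 1 * z.1 + 0 * z.2)
      MeasurableSet.univ, Set.preimage_univ] at hmap
    simp only [Measure.real, hmap]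
  refine Measure.ext_of_charFunDual (funext fun L => ?_)
  have hL : ⇑L = fun z : ℝ × ℝ => L (1, 0) * z.1 + L (0, 1) * z.2 := by
    funext z
    have hz : z = z.1 • ((1, 0) : ℝ × ℝ) + z.2 • ((0, 1) : ℝ × ℝ) := by ext <;> simp
    conv_lhs => rw [hz]
    simp only [map_add, map_smul, smul_eq_mul]
    ring
  by_cases h0 : L (1, 0) = 0 ∧ L (0, 1) = 0
  · have : L = 0 := by
      ext <;> simp [h0]
    simp [this, charFunDual_apply, mass]
  · rw [charFunDual_eq_charFun_map_one, charFunDual_eq_charFun_map_one, hL, h _ _ h0]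
end

section
/- Let μ₁ and μ₂ be finite signed Borel measures on ℝ². If for all real numbers a, b not both zero the pushforward signed measures of μ₁ and μ₂ along the map (x,y) ↦ ax + by from ℝ² to ℝ are equal, then μ₁ = μ₂. -/
open MeasureTheory

/-- Moving negative parts across, two signed measures agree on a measurable set iff the
corresponding sums of positive and negative parts do. -/
theorem MeasureTheory.SignedMeasure.apply_eq_apply_iff_posPart_add_negPart
    {α : Type*} [MeasurableSpace α] (μ ν : SignedMeasure α) {s : Set α} (hs : MeasurableSet s) :
    μ s = ν s ↔
      (μ.toJordanDecomposition.posPart + ν.toJordanDecomposition.negPart) s =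
        (ν.toJordanDecomposition.posPart + μ.toJordanDecomposition.negPart) s := by
  rw [μ.apply_eq_posPart_real_sub_negPart_real hs, ν.apply_eq_posPart_real_sub_negPart_real hs,
    ← measureReal_eq_measureReal_iff, measureReal_add_apply, measureReal_add_apply]
  constructor <;> intro h <;> linarith

/-- Two finite measures on a separable Banach space with the same pushforwards along all
continuous linear functionals are equal. -/
theorem MeasureTheory.Measure.ext_of_map_dual {E : Type*} [NormedAddCommGroup E]
    [NormedSpace ℝ E] [CompleteSpace E] [SecondCountableTopology E] [MeasurableSpace E]
    [BorelSpace E] {μ ν : Measure E} [IsFiniteMeasure μ] [IsFiniteMeasure ν]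
    (h : ∀ L : E →L[ℝ] ℝ, μ.map L = ν.map L) : μ = ν := by
  refine Measure.ext_of_charFunDual (funext fun L ↦ ?_)
  rw [charFunDual_eq_charFun_map_one, charFunDual_eq_charFun_map_one, h]

/-- If two finite signed Borel measures on ℝ² have equal pushforwards along
every map `(x,y) ↦ ax + by` with `a, b` not both zero, then they are equal. -/
theorem signed_measures_eq_of_linear_pushforwards_eq
    (μ₁ μ₂ : SignedMeasure (ℝ × ℝ))
    (h : ∀ a b : ℝ, ¬(a = 0 ∧ b = 0) →
      VectorMeasure.map μ₁ (fun z : ℝ × ℝ => a * z.1 + b * z.2) =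
      VectorMeasure.map μ₂ (fun z : ℝ × ℝ => a * z.1 + b * z.2)) :
    μ₁ = μ₂ := by
  have h_pre : ∀ a b : ℝ, ¬(a = 0 ∧ b = 0) → ∀ s : Set ℝ, MeasurableSet s →
      μ₁ ((fun z : ℝ × ℝ => a * z.1 + b * z.2) ⁻¹' s) =
        μ₂ ((fun z : ℝ × ℝ => a * z.1 + b * z.2) ⁻¹' s) := by
    intro a b hab s hs
    have hm : Measurable (fun z : ℝ × ℝ => a * z.1 + b * z.2) := by fun_prop
    rw [← VectorMeasure.map_apply _ hm hs, ← VectorMeasure.map_apply _ hm hs, h a b hab]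
  have h_univ : μ₁ Set.univ = μ₂ Set.univ := by
    simpa using h_pre 1 0 (by simp) Set.univ .univ
  have h_eq : μ₁.toJordanDecomposition.posPart + μ₂.toJordanDecomposition.negPart =
      μ₂.toJordanDecomposition.posPart + μ₁.toJordanDecomposition.negPart := by
    refine Measure.ext_of_map_dual fun L ↦ Measure.ext fun s hs ↦ ?_
    have hL : Measurable L := L.continuous.measurable
    rw [Measure.map_apply hL hs, Measure.map_apply hL hs,
      ← SignedMeasure.apply_eq_apply_iff_posPart_add_negPart _ _ (hL hs)]
    have h_coord : (L : ℝ × ℝ → ℝ) = fun z ↦ L (1, 0) * z.1 + L (0, 1) * z.2 := by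
      funext z
      have hz : z = z.1 • ((1, 0) : ℝ × ℝ) + z.2 • ((0, 1) : ℝ × ℝ) := by ext <;> simp
      conv_lhs => rw [hz, map_add, map_smul, map_smul, smul_eq_mul, smul_eq_mul]
      ring
    by_cases h_zero : L (1, 0) = 0 ∧ L (0, 1) = 0
    · by_cases h_mem : (0 : ℝ) ∈ s <;> rw [h_coord] <;> simp [h_zero, h_mem, h_univ]
    · rw [h_coord]
      exact h_pre _ _ h_zero s hs
  refine VectorMeasure.ext fun s hs ↦ ?_
  rw [SignedMeasure.apply_eq_apply_iff_posPart_add_negPart _ _ hs, h_eq]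
end

section
/- Let f : ℝ² → ℝ be an integrable function, let a, b be real numbers with b ≠ 0, and define g : ℝ → ℝ by g(z) = (1/|b|) ∫_ℝ f(x, (z − ax)/b) dx. Then for every real ζ, the one-dimensional Fourier transform of g satisfies ĝ(ζ) = √(2π) · f̂(aζ, bζ), where f̂ is the two-dimensional Fourier transform of f. -/
open MeasureTheory Complex

/-- The change of coordinates `(x, y) ↦ (x, a x + b y)` of the plane, for `b ≠ 0`. -/
noncomputable def shearScale (a b : ℝ) (hb : b ≠ 0) : ℝ × ℝ ≃ᵐ ℝ × ℝ where
  toFun w := (w.1, a * w.1 + b * w.2)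
  invFun w := (w.1, (w.2 - a * w.1) / b)
  left_inv w := by ext <;> simp [hb]
  right_inv w := by ext <;> simp [mul_div_cancel₀, hb]
  measurable_toFun := by simp only [Equiv.coe_fn_mk]; fun_prop
  measurable_invFun := by simp only [Equiv.coe_fn_symm_mk]; fun_prop

theorem measurePreserving_shearScale (a b : ℝ) (hb : b ≠ 0) :
    MeasurePreserving (shearScale a b hb) volume (ENNReal.ofReal |b⁻¹| • volume) := by
  have h : MeasurePreserving (fun w : ℝ × ℝ => (w.1, a * w.1 + b * w.2)) (volume.prod volume)
      ((volume : Measure ℝ).prod (ENNReal.ofReal |b⁻¹| • (volume : Measure ℝ))) := by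
    refine (MeasurePreserving.id volume).skew_product (g := fun x y => a * x + b * y)
      (by fun_prop) (Filter.Eventually.of_forall fun x => ?_)
    calc Measure.map (fun y => a * x + b * y) volume
        = Measure.map (fun y => a * x + y) (Measure.map (b * ·) volume) :=
          (Measure.map_map (by fun_prop) (by fun_prop)).symm
      _ = ENNReal.ofReal |b⁻¹| • volume := by
        rw [Real.map_volume_mul_left hb, Measure.map_smul, map_add_left_eq_self]
  rw [Measure.prod_smul_right] at h
  exact h

theorem integral_eq_smul_integral_integral_line {E : Type*} [NormedAddCommGroup E]
    [NormedSpace ℝ E] {F : ℝ × ℝ → E} (hF : Integrable F) (a b : ℝ) (hb : b ≠ 0) :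
    ∫ w, F w = |b|⁻¹ • ∫ z : ℝ, ∫ x : ℝ, F (x, (z - a * x) / b) := by
  have hS := measurePreserving_shearScale a b hb
  have hc : ENNReal.ofReal |b⁻¹| ≠ 0 := by simp [hb]
  have hFS : F = (F ∘ (shearScale a b hb).symm) ∘ shearScale a b hb := by
    ext w; simp
  have hint : Integrable (F ∘ (shearScale a b hb).symm) (volume.prod volume) := by
    rw [hFS, hS.integrable_comp_emb (shearScale a b hb).measurableEmbedding,
      integrable_smul_measure hc ENNReal.ofReal_ne_top] at hF
    exact hF
  calc ∫ w, F w = ∫ w, (F ∘ (shearScale a b hb).symm) (shearScale a b hb w) := by simp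
    _ = |b|⁻¹ • ∫ w, (F ∘ (shearScale a b hb).symm) w := by
      rw [hS.integral_comp (shearScale a b hb).measurableEmbedding, integral_smul_measure,
        ENNReal.toReal_ofReal (abs_nonneg _), abs_inv]
    _ = _ := by
      rw [Measure.volume_eq_prod, integral_prod_symm _ hint]
      rfl

/-- For integrable `f : ℝ² → ℝ` and reals `a, b` with `b ≠ 0`, the function
`g(z) = |b|⁻¹ ∫ f(x, (z−ax)/b) dx` satisfies `ĝ(ζ) = √(2π) · f̂(aζ, bζ)`, where
`ĝ(ζ) = (2π)^{-1/2} ∫ g(z) e^{−iζz} dz` and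
`f̂(ξ,η) = (2π)^{-1} ∬ f(x,y) e^{−i(ξx+ηy)} dx dy`. -/
theorem fourier_of_linear_marginal_density
    (f : ℝ × ℝ → ℝ) (hf : Integrable f) (a b : ℝ) (hb : b ≠ 0)
    (g : ℝ → ℝ) (hg : g = fun z => |b|⁻¹ * ∫ x : ℝ, f (x, (z - a * x) / b))
    (ζ : ℝ) :
    ((Real.sqrt (2 * Real.pi))⁻¹ : ℂ) * ∫ z : ℝ, (g z : ℂ) * Complex.exp (-(I * ζ * z)) =
      (Real.sqrt (2 * Real.pi) : ℂ) *
        (((2 * Real.pi)⁻¹ : ℝ) *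
          ∫ w : ℝ × ℝ, (f w : ℂ) * Complex.exp (-(I * (a * ζ * w.1 + b * ζ * w.2)))) := by
  have hF : Integrable fun w : ℝ × ℝ =>
      (f w : ℂ) * Complex.exp (-(I * (a * ζ * w.1 + b * ζ * w.2))) := by
    refine hf.ofReal.mul_bdd (c := 1) (Continuous.aestronglyMeasurable (by fun_prop))
      (Filter.Eventually.of_forall fun w => le_of_eq ?_)
    rw [Complex.norm_exp]
    simp
  have hb' : (b : ℂ) ≠ 0 := by exact_mod_cast hb
  have hline (z x : ℝ) : (f (x, (z - a * x) / b) : ℂ) *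
      Complex.exp (-(I * (a * ζ * (x : ℝ) + b * ζ * ((z - a * x) / b : ℝ)))) =
      f (x, (z - a * x) / b) * Complex.exp (-(I * ζ * z)) := by
    congr 2
    push_cast
    field_simp
    ring
  have hsqrt : (Real.sqrt (2 * Real.pi) : ℂ) * ((2 * Real.pi)⁻¹ : ℝ) =
      (Real.sqrt (2 * Real.pi) : ℂ)⁻¹ := by
    rw [← ofReal_mul, ← ofReal_inv, ← div_eq_mul_inv, Real.sqrt_div_self', one_div]
  rw [integral_eq_smul_integral_integral_line hF a b hb, ← mul_assoc, hsqrt]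
  simp only [hline, hg, integral_mul_const, integral_complex_ofReal, ofReal_mul, real_smul]
  simp only [mul_assoc, integral_const_mul]
end

section
/- Let ψ : ℝ → ℂ be a Schwartz function with Wigner function w(x,p) = (1/(2π)) ∫_ℝ conj(ψ(x + γ/2)) ψ(x − γ/2) e^{iγp} dγ, and let ψ̂ be the Fourier transform of ψ. Then for every real p, the p-marginal of w is |ψ̂(p)|²: ∫_ℝ w(x,p) dx = |ψ̂(p)|². -/
open Complex MeasureTheory

open scoped Convolution in
/-- The change of variables `u = x + γ / 2`, `v = x - γ / 2` turns the iterated integral of a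
product into a product of integrals. -/
theorem integral_integral_mul_add_sub_half {F G : ℝ → ℂ} (hF : Integrable F) (hG : Integrable G) :
    ∫ x : ℝ, ∫ γ : ℝ, F (x + γ / 2) * G (x - γ / 2) = (∫ u, F u) * ∫ v, G v := by
  have inner_eq (x : ℝ) : ∫ γ : ℝ, F (x + γ / 2) * G (x - γ / 2) =
      2 * (F ⋆[ContinuousLinearMap.mul ℝ ℂ] G) (2 * x) := by
    have h₁ := Measure.integral_comp_div (fun s : ℝ => F (x + s) * G (x - s)) 2
    have h₂ := integral_add_left_eq_self (μ := volume) (fun u : ℝ => F u * G (2 * x - u)) x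
    rw [h₁, convolution_def]
    simp only [ContinuousLinearMap.mul_apply']
    rw [← h₂]
    have h₃ (s : ℝ) : 2 * x - (x + s) = x - s := by ring
    simp [h₃]
  simp only [inner_eq]
  rw [integral_const_mul, Measure.integral_comp_mul_left (F ⋆[ContinuousLinearMap.mul ℝ ℂ] G) 2,
    integral_convolution _ hF hG]
  simp

/-- For a Schwartz function `ψ : ℝ → ℂ` with Wigner function
`w(x,p) = (2π)⁻¹ ∫ conj(ψ(x+γ/2)) ψ(x−γ/2) e^{iγp} dγ` and Fourier transform
`ψ̂(ξ) = (2π)^{-1/2} ∫ ψ(x) e^{−iξx} dx`, the p-marginal of `w` is `|ψ̂(p)|²`: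
for every real `p`, `∫ w(x,p) dx = |ψ̂(p)|²`. -/
theorem wigner_p_marginal
    (ψ : SchwartzMap ℝ ℂ) (w : ℝ → ℝ → ℂ)
    (hw : w = fun (x p : ℝ) => ((2 * Real.pi)⁻¹ : ℝ) *
      ∫ γ : ℝ, (starRingEnd ℂ) (ψ (x + γ / 2)) * ψ (x - γ / 2) * Complex.exp (I * γ * p))
    (ψhat : ℝ → ℂ)
    (hψhat : ψhat = fun ξ : ℝ => ((Real.sqrt (2 * Real.pi))⁻¹ : ℝ) *
      ∫ x : ℝ, ψ x * Complex.exp (-(I * ξ * x)))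
    (p : ℝ) :
    ∫ x : ℝ, w x p = (‖ψhat p‖ ^ 2 : ℝ) := by
  subst hw hψhat
  set G : ℝ → ℂ := fun x => ψ x * Complex.exp (-(I * p * x)) with hGdef
  have hG : Integrable G := by
    refine ψ.integrable.mono (by fun_prop) (.of_forall fun x => ?_)
    simp [hGdef, Complex.norm_exp]
  have hF : Integrable fun x => (starRingEnd ℂ) (G x) :=
    hG.mono (Complex.continuous_conj.comp_aestronglyMeasurable hG.1) (.of_forall fun x => by simp)
  have integrand_eq (x γ : ℝ) :
      (starRingEnd ℂ) (ψ (x + γ / 2)) * ψ (x - γ / 2) * Complex.exp (I * γ * p) =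
        (starRingEnd ℂ) (G (x + γ / 2)) * G (x - γ / 2) := by
    have hexp : Complex.exp (I * γ * p) =
        Complex.exp (I * p * (x + γ / 2)) * Complex.exp (-(I * p * (x - γ / 2))) := by
      rw [← Complex.exp_add]
      ring_nf
    simp only [hGdef, map_mul, ← Complex.exp_conj, map_neg, Complex.conj_I, Complex.conj_ofReal,
      hexp]
    push_cast
    ring_nf
  simp only [integrand_eq]
  rw [integral_const_mul, integral_integral_mul_add_sub_half hF hG, integral_conj,
    ← Complex.normSq_eq_conj_mul_self, Complex.normSq_eq_norm_sq, norm_mul, mul_pow,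
    Complex.norm_real, Real.norm_eq_abs, sq_abs, inv_pow, Real.sq_sqrt (by positivity)]
  push_cast
  rfl
end

section
/- Let ψ : ℝ → ℂ be a Schwartz function with Wigner function w(x,p) = (1/(2π)) ∫_ℝ conj(ψ(x + γ/2)) ψ(x − γ/2) e^{iγp} dγ, and let a be any real number. Then for every real r, the marginal of w along the line ax + p = r equals the probability density of the observable aX + P at r: ∫_ℝ w(x, r − a x) dx = (1/(2π)) | ∫_ℝ e^{−i r x + i a x²/2} ψ(x) dx |². -/
open Complex MeasureTheory

/-- Integrating `G (2 x - t)` over `x` gives half the integral of `G`. -/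
lemma integral_comp_two_mul_sub {E : Type*} [NormedAddCommGroup E] [NormedSpace ℝ E]
    (G : ℝ → E) (t : ℝ) : ∫ x : ℝ, G (2 * x - t) = (2⁻¹ : ℝ) • ∫ y : ℝ, G y := by
  rw [Measure.integral_comp_mul_left (fun y => G (y - t)), integral_sub_right_eq_self]
  norm_num

/-- The function `(x, t) ↦ f t * g (2 x - t)` is integrable on the plane. -/
lemma integrable_mul_comp_two_mul_sub {f g : ℝ → ℂ} (hf : Integrable f) (hg : Integrable g)
    (hfc : Continuous f) (hgc : Continuous g) :
    Integrable (fun z : ℝ × ℝ => f z.2 * g (2 * z.1 - z.2)) (volume.prod volume) := by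
  have hmeas : AEStronglyMeasurable (fun z : ℝ × ℝ => f z.2 * g (2 * z.1 - z.2))
      (volume.prod volume) :=
    Continuous.aestronglyMeasurable (by fun_prop)
  refine (integrable_prod_iff' hmeas).2 ⟨.of_forall fun t => ?_, ?_⟩
  · exact ((hg.comp_sub_right t).comp_mul_left' two_ne_zero).const_mul (f t)
  · simp only [norm_mul, integral_const_mul, integral_comp_two_mul_sub (fun y => ‖g y‖)]
    exact hf.norm.mul_const _

/-- Integrating `f ⊗ g` in the midpoint and difference coordinates gives the product of the
integrals. -/
lemma integral_integral_midpoint_difference {f g : ℝ → ℂ} (hf : Integrable f)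
    (hg : Integrable g) (hfc : Continuous f) (hgc : Continuous g) :
    ∫ x : ℝ, ∫ γ : ℝ, f (x + γ / 2) * g (x - γ / 2) = (∫ t, f t) * ∫ t, g t := by
  have hinner (x : ℝ) : ∫ γ : ℝ, f (x + γ / 2) * g (x - γ / 2) =
      (2 : ℂ) * ∫ t : ℝ, f t * g (2 * x - t) := by
    have h := Measure.integral_comp_div (fun s : ℝ => f (x + s) * g (2 * x - (x + s))) 2
    rw [integral_add_left_eq_self (fun t => f t * g (2 * x - t)) x] at h
    calc _ = ∫ γ : ℝ, f (x + γ / 2) * g (2 * x - (x + γ / 2)) := by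
          congr! 4
          ring
      _ = _ := by simpa using h
  simp_rw [hinner]
  rw [integral_const_mul,
    integral_integral_swap (integrable_mul_comp_two_mul_sub hf hg hfc hgc)]
  simp_rw [integral_const_mul, integral_comp_two_mul_sub, Complex.real_smul]
  rw [integral_mul_const]
  push_cast
  ring

/-- For a Schwartz function `ψ : ℝ → ℂ` with Wigner function
`w(x,p) = (2π)⁻¹ ∫ conj(ψ(x+γ/2)) ψ(x−γ/2) e^{iγp} dγ` and any real `a`, the marginal
of `w` along the line `ax + p = r` equals the probability density of the observable
`aX + P` at `r`:
`∫ w(x, r − ax) dx = (2π)⁻¹ |∫ e^{−irx + iax²/2} ψ(x) dx|²`. -/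
theorem wigner_marginal_eq_density_of_aX_plus_P
    (ψ : SchwartzMap ℝ ℂ) (w : ℝ → ℝ → ℂ)
    (hw : w = fun (x p : ℝ) => ((2 * Real.pi)⁻¹ : ℝ) *
      ∫ γ : ℝ, (starRingEnd ℂ) (ψ (x + γ / 2)) * ψ (x - γ / 2) * Complex.exp (I * γ * p))
    (a : ℝ) (r : ℝ) :
    ∫ x : ℝ, w x (r - a * x) =
      (((2 * Real.pi)⁻¹ : ℝ) *
        (‖∫ x : ℝ, Complex.exp (-(I * r * x) + I * a * x ^ 2 / 2) * ψ x‖ ^ 2 : ℝ) : ℝ) := by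
  set F : ℝ → ℂ := fun x => Complex.exp (-(I * r * x) + I * a * x ^ 2 / 2) * ψ x with hF
  have hFc : Continuous F := by
    have := ψ.continuous
    fun_prop
  have hFi : Integrable F := by
    refine ψ.integrable.mono hFc.aestronglyMeasurable (.of_forall fun x => le_of_eq ?_)
    have h : -(I * r * x) + I * a * x ^ 2 / 2 = ((-(r * x) + a * x ^ 2 / 2 : ℝ) : ℂ) * I := by
      push_cast
      ring
    rw [hF, norm_mul, h, norm_exp_ofReal_mul_I, one_mul]
  have hconj : Integrable (fun x => (starRingEnd ℂ) (F x)) :=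
    hFi.mono (continuous_conj.comp hFc).aestronglyMeasurable (.of_forall fun x => by simp)
  have hintegrand (x γ : ℝ) : (starRingEnd ℂ) (ψ (x + γ / 2)) * ψ (x - γ / 2) *
      Complex.exp (I * γ * (r - a * x : ℝ)) =
      (starRingEnd ℂ) (F (x + γ / 2)) * F (x - γ / 2) := by
    have h : Complex.exp (I * γ * (r - a * x : ℝ)) =
        (starRingEnd ℂ) (Complex.exp (-(I * r * (x + γ / 2 : ℝ)) +
          I * a * (x + γ / 2 : ℝ) ^ 2 / 2)) *
        Complex.exp (-(I * r * (x - γ / 2 : ℝ)) + I * a * (x - γ / 2 : ℝ) ^ 2 / 2) := by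
      rw [← exp_conj, ← Complex.exp_add]
      simp only [map_add, map_neg, map_mul, map_div₀, map_pow, conj_I, conj_ofReal, map_ofNat]
      push_cast
      ring_nf
    rw [h, hF, map_mul]
    ring
  simp_rw [hw, hintegrand]
  rw [integral_const_mul, integral_integral_midpoint_difference hconj hFi
    (continuous_conj.comp hFc) hFc, integral_conj, conj_mul']
  push_cast
  rfl
end
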